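/- Let {a_n}_{n=1}^{N^{1/2}} be an N^{1/2}-short generalized Dirichlet sequence with parameters (N,θ), 1 ≤ L ≤ N^{1/2} dividing N^{1/2}, and fix P(L) = P(L,y). There is an absolute constant c > 0 with the following property. Suppose g₁ = Σ_I a_I 1_{P_I} and g₂ = Σ_J b_J 1_{P_J}, where a_I, b_J are positive reals, I, J range over elements of 𝓘, each P_I (resp. P_J) is a translate of P_I(0) (resp. P_J(0)), and every pair (I,J) occurring is transversal, i.e. |v_I^{-1} − v_J^{-1}| ≥ c N^{1/2}θ. Then ⨍_{P(L)} g₁ g₂ ≤ C (⨍_{2P(L)} g₁)(⨍_{2P(L)} g₂) for an absolute constant C, where ⨍_E g = |E|^{-1} ∫_E g and 2P(L) is the fat AP with thickness and diameter doubled. -/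

import Mathlib

open MeasureTheory

/-- The `δ`-neighborhood of the arithmetic progression through `x₀` with common
difference `v`. -/
def APnbhd (v δ x₀ : ℝ) : Set ℝ :=
  {x : ℝ | ∃ m : ℤ, |x - (x₀ + (m : ℝ) * v)| ≤ δ}

/-- `{a_n}_{n=1}^{R}` is an `N^{1/2}`-short generalized Dirichlet sequence with
parameters `(N, θ)`. -/
def ShortGDS (N : ℝ) (R : ℕ) (θ : ℝ) (a : ℕ → ℝ) : Prop :=
  a 2 - a 1 ∈ Set.Icc (1 / (4 * N)) (4 / N) ∧
  ∀ i : ℕ, 1 ≤ i → i + 2 ≤ R →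
    (a (i + 2) - a (i + 1)) - (a (i + 1) - a i) ∈
      Set.Icc (θ / (4 * N ^ 2)) (4 * θ / N ^ 2)

/-- The common difference `v_j = a_{(j-1)L+2} - a_{(j-1)L+1}`. -/
def vdiff (a : ℕ → ℝ) (L j : ℕ) : ℝ :=
  a ((j - 1) * L + 2) - a ((j - 1) * L + 1)

/-- The dual fat AP `P_{I_j}(x) = P_{v_j⁻¹}^{CN/L}(x) ∩ B_{CN²/(L²θ)}(x)`. -/
def PIset (C N θ : ℝ) (L : ℕ) (a : ℕ → ℝ) (j : ℕ) (x : ℝ) : Set ℝ :=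
  APnbhd (vdiff a L j)⁻¹ (C * N / L) x ∩
    Metric.closedBall x (C * N ^ 2 / ((L : ℝ) ^ 2 * θ))

/-- The "ball" `s·P(L,y) = P_{v₁⁻¹}^{sCN^{3/2}/L²}(y) ∩ B_{sCN²/(L²θ)}(y)` (dilated
by `s`). -/
noncomputable def PLset (s C N θ : ℝ) (L : ℕ) (a : ℕ → ℝ) (y : ℝ) : Set ℝ :=
  APnbhd (a 2 - a 1)⁻¹ (s * (C * N ^ ((3 : ℝ) / 2) / (L : ℝ) ^ 2)) y ∩
    Metric.closedBall y (s * (C * N ^ 2 / ((L : ℝ) ^ 2 * θ)))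

lemma measurableSet_APnbhd (v δ x : ℝ) : MeasurableSet (APnbhd v δ x) := by
  have : APnbhd v δ x = ⋃ m : ℤ, Metric.closedBall (x + (m : ℝ) * v) δ := by
    ext t
    simp [APnbhd, Metric.mem_closedBall, Real.dist_eq]
  rw [this]
  exact MeasurableSet.iUnion fun m => Metric.isClosed_closedBall.measurableSet

lemma Int.ncard_le_of_forall_abs_sub_le {Z : Set ℤ} {X : ℝ} (hX : 0 ≤ X)
    (hZ : ∀ p ∈ Z, ∀ q ∈ Z, |(p : ℝ) - q| ≤ X) : Z.Finite ∧ (Z.ncard : ℝ) ≤ X + 1 := by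
  rcases Z.eq_empty_or_nonempty with rfl | ⟨p₀, hp₀⟩
  · simp; linarith
  have hfin : Z.Finite := by
    refine (Set.finite_Icc (p₀ - ⌈X⌉) (p₀ + ⌈X⌉)).subset fun q hq => ?_
    have h := abs_le.1 (hZ p₀ hp₀ q hq)
    have h' := Int.le_ceil X
    constructor
    · have : ((p₀ - ⌈X⌉ : ℤ) : ℝ) ≤ q := by push_cast; linarith
      exact_mod_cast this
    · have : (q : ℝ) ≤ ((p₀ + ⌈X⌉ : ℤ) : ℝ) := by push_cast; linarith
      exact_mod_cast this
  refine ⟨hfin, ?_⟩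
  obtain ⟨p, hp, hpmin⟩ := Set.exists_min_image Z id hfin ⟨p₀, hp₀⟩
  obtain ⟨q, hq, hqmax⟩ := Set.exists_max_image Z id hfin ⟨p₀, hp₀⟩
  have hpq : p ≤ q := hpmin q hq
  have hsub : Z ⊆ (Finset.Icc p q : Finset ℤ) := fun z hz => by
    simpa using ⟨hpmin z hz, hqmax z hz⟩
  have hcard := Set.ncard_le_ncard hsub (Finset.finite_toSet _)
  rw [Set.ncard_coe_finset, Int.card_Icc] at hcard
  have h1 : ((q + 1 - p).toNat : ℝ) = q + 1 - p := by
    have : ((q + 1 - p).toNat : ℤ) = q + 1 - p := Int.toNat_of_nonneg (by omega)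
    exact_mod_cast this
  have h2 : (Z.ncard : ℝ) ≤ ((q + 1 - p).toNat : ℝ) := by exact_mod_cast hcard
  have h3 := (abs_le.1 (hZ q hq p hp)).2
  linarith

lemma volume_le_of_subset_biUnion_int {Z : Set ℤ} {E : ℤ → Set ℝ} {S : Set ℝ} {X V : ℝ}
    (hX : 0 ≤ X) (hV : 0 ≤ V) (hZ : ∀ p ∈ Z, ∀ q ∈ Z, |(p : ℝ) - q| ≤ X)
    (hS : S ⊆ ⋃ p ∈ Z, E p) (hE : ∀ p ∈ Z, volume (E p) ≤ ENNReal.ofReal V) :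
    volume S ≤ ENNReal.ofReal ((X + 1) * V) := by
  obtain ⟨hfin, hcard⟩ := Int.ncard_le_of_forall_abs_sub_le hX hZ
  have hS' : S ⊆ ⋃ p ∈ hfin.toFinset, E p := by simpa using hS
  calc volume S ≤ ∑ p ∈ hfin.toFinset, volume (E p) :=
        (measure_mono hS').trans (measure_biUnion_finset_le _ _)
    _ ≤ ∑ _p ∈ hfin.toFinset, ENNReal.ofReal V :=
        Finset.sum_le_sum fun p hp => hE p (by simpa using hp)
    _ = ENNReal.ofReal (Z.ncard * V) := by
        rw [Finset.sum_const, nsmul_eq_mul, ENNReal.ofReal_mul (by positivity),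
          ENNReal.ofReal_natCast, Set.ncard_eq_toFinset_card _ hfin]
    _ ≤ ENNReal.ofReal ((X + 1) * V) := ENNReal.ofReal_le_ofReal (by gcongr)

lemma volume_fatAP_le {s δ ρ : ℝ} (x : ℝ) (hs : 0 < s) (hδ : 0 ≤ δ) (hρ : 0 ≤ ρ) :
    volume (APnbhd s δ x ∩ Metric.closedBall x ρ) ≤
      ENNReal.ofReal ((2 * (ρ + δ) / s + 1) * (2 * δ)) := by
  refine volume_le_of_subset_biUnion_int (Z := {m : ℤ | |(m : ℝ) * s| ≤ ρ + δ})
    (E := fun m => Metric.closedBall (x + (m : ℝ) * s) δ) (by positivity) (by positivity)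
    ?_ ?_ ?_
  · intro p hp q hq
    have hp' := abs_le.1 (show |(p : ℝ) * s| ≤ ρ + δ from hp)
    have hq' := abs_le.1 (show |(q : ℝ) * s| ≤ ρ + δ from hq)
    have : |((p : ℝ) - q) * s| ≤ 2 * (ρ + δ) := by
      rw [abs_le]
      constructor <;> linarith
    rwa [abs_mul, abs_of_pos hs, ← le_div_iff₀ hs] at this
  · rintro t ⟨⟨m, hm⟩, ht⟩
    rw [Metric.mem_closedBall, Real.dist_eq] at ht
    refine Set.mem_biUnion (x := m) ?_ (by rwa [Metric.mem_closedBall, Real.dist_eq])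
    show |(m : ℝ) * s| ≤ ρ + δ
    rw [abs_le] at *
    constructor <;> linarith
  · intro p _
    rw [Real.volume_closedBall]

lemma volume_fatAP_inter_le {s₁ s₂ w ρ : ℝ} (x₁ x₂ : ℝ) (hs₁ : 0 < s₁) (hs₂ : 0 < s₂)
    (hne : s₁ ≠ s₂) (hw : 0 ≤ w) (hρ : 0 ≤ ρ) :
    volume ((APnbhd s₁ w x₁ ∩ Metric.closedBall x₁ ρ) ∩
        (APnbhd s₂ w x₂ ∩ Metric.closedBall x₂ ρ)) ≤
      ENNReal.ofReal (((4 * w + 2 * (ρ + w) / s₁ * |s₁ - s₂|) / s₂ + 1) *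
        ((4 * w / |s₁ - s₂| + 1) * (2 * w))) := by
  have hd : 0 < |s₁ - s₂| := abs_pos.2 (sub_ne_zero.2 hne)
  set M : ℤ → Set ℤ := fun k =>
    {m : ℤ | |(m : ℝ) * s₁| ≤ ρ + w ∧ |x₁ - x₂ + m * (s₁ - s₂) - k * s₂| ≤ 2 * w} with hM
  refine volume_le_of_subset_biUnion_int (Z := {k : ℤ | (M k).Nonempty})
    (E := fun k => ⋃ m ∈ M k, Metric.closedBall (x₁ + (m : ℝ) * s₁) w) (by positivity)
    (by positivity) ?_ ?_ ?_
  · rintro p ⟨m, hm, hp⟩ q ⟨n, hn, hq⟩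
    rw [le_div_iff₀ hs₂]
    have hmn : |(m : ℝ) - n| ≤ 2 * (ρ + w) / s₁ := by
      have : |((m : ℝ) - n) * s₁| ≤ 2 * (ρ + w) := by
        rw [abs_le] at *
        constructor <;> linarith
      rwa [abs_mul, abs_of_pos hs₁, ← le_div_iff₀ hs₁] at this
    have h1 : ((p : ℝ) - q) * s₂ = (x₁ - x₂ + n * (s₁ - s₂) - q * s₂) -
        (x₁ - x₂ + m * (s₁ - s₂) - p * s₂) + (m - n) * (s₁ - s₂) := by ring
    calc |(p : ℝ) - q| * s₂ = |((p : ℝ) - q) * s₂| := by rw [abs_mul, abs_of_pos hs₂]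
      _ ≤ |x₁ - x₂ + n * (s₁ - s₂) - q * s₂| + |x₁ - x₂ + m * (s₁ - s₂) - p * s₂| +
          |(m - n) * (s₁ - s₂)| := by
          rw [h1]
          exact (abs_add_le _ _).trans (add_le_add_left (abs_sub _ _) _)
      _ ≤ 4 * w + 2 * (ρ + w) / s₁ * |s₁ - s₂| := by
          rw [abs_mul]
          have := mul_le_mul_of_nonneg_right hmn hd.le
          linarith
  · rintro t ⟨⟨⟨m, hm⟩, ht₁⟩, ⟨n, hn⟩, ht₂⟩
    rw [Metric.mem_closedBall, Real.dist_eq] at ht₁ ht₂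
    have hmem : m ∈ M (n - m) := by
      refine ⟨?_, ?_⟩
      · rw [abs_le] at *
        constructor <;> linarith
      · push_cast
        rw [abs_le] at *
        constructor <;> linarith
    exact Set.mem_biUnion (x := n - m) ⟨m, hmem⟩
      (Set.mem_biUnion hmem (by rwa [Metric.mem_closedBall, Real.dist_eq]))
  · intro k _
    refine volume_le_of_subset_biUnion_int (Z := M k)
      (E := fun m => Metric.closedBall (x₁ + (m : ℝ) * s₁) w) (by positivity)
      (by positivity) ?_ subset_rfl fun m _ => by rw [Real.volume_closedBall]
    rintro p ⟨-, hp⟩ q ⟨-, hq⟩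
    rw [le_div_iff₀ hd, ← abs_mul]
    rw [abs_le] at *
    constructor <;> linarith

lemma mul_le_volume_real_of_Icc_subset {S : Set ℝ} (hS : volume S ≠ ⊤) {p q l : ℝ} (n : ℕ)
    (hl : 0 ≤ l) (hq : l < |q|)
    (h : ∀ k ∈ Finset.Icc 1 n, Set.Icc (p + k * q) (p + k * q + l) ⊆ S) :
    n * l ≤ volume.real S := by
  have hdisj : ((Finset.Icc 1 n : Finset ℕ) : Set ℕ).PairwiseDisjoint
      fun k : ℕ => Set.Icc (p + k * q) (p + k * q + l) := by
    intro i _ j _ hij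
    refine Set.disjoint_left.2 fun t hi hj => ?_
    have h1 : (1 : ℝ) ≤ |(i : ℝ) - j| := by
      have : (1 : ℤ) ≤ |(i : ℤ) - j| := Int.one_le_abs (by omega)
      exact_mod_cast this
    have h2 : |((i : ℝ) - j) * q| ≤ l := by
      rw [abs_le]
      constructor <;> linarith [hi.1, hi.2, hj.1, hj.2]
    rw [abs_mul] at h2
    nlinarith [abs_nonneg q]
  have hsub : (⋃ k ∈ Finset.Icc 1 n, Set.Icc (p + k * q) (p + k * q + l)) ⊆ S :=
    Set.iUnion₂_subset h
  calc n * l = ∑ k ∈ Finset.Icc 1 n, volume.real (Set.Icc (p + k * q) (p + k * q + l)) := by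
        simp [hl]
    _ = volume.real (⋃ k ∈ Finset.Icc 1 n, Set.Icc (p + k * q) (p + k * q + l)) :=
        (measureReal_biUnion_finset hdisj (fun _ _ => measurableSet_Icc)
          (fun _ _ => by simp)).symm
    _ ≤ volume.real S := measureReal_mono hsub hS

lemma mul_le_volume_real_fatAP_inter {s s' w W x y ρ l t₀ : ℝ} (n : ℕ) (hl : 0 ≤ l)
    (hlw : l ≤ w) (hls : l < s) (hW : n * |s - s'| + l ≤ W) (hρ : n * s + l ≤ ρ)
    (h₁ : t₀ ∈ APnbhd s w x ∩ Metric.closedBall x ρ)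
    (h₂ : t₀ ∈ APnbhd s' W y ∩ Metric.closedBall y ρ) :
    n * l ≤ volume.real ((APnbhd s w x ∩ Metric.closedBall x ρ) ∩
      (APnbhd s' (2 * W) y ∩ Metric.closedBall y (2 * ρ))) := by
  obtain ⟨⟨m, hm⟩, hx⟩ := h₁
  obtain ⟨⟨m', hm'⟩, hy⟩ := h₂
  rw [Metric.mem_closedBall, Real.dist_eq] at hx hy
  have hs : 0 < s := hl.trans_lt hls
  obtain ⟨u, hul, hu0, hu⟩ : ∃ u : ℝ, -l ≤ u ∧ u ≤ 0 ∧ ∀ t ∈ Set.Icc (t₀ + u) (t₀ + u + l),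
      |t - (x + m * s)| ≤ w := by
    rw [abs_le] at hm
    rcases le_total t₀ (x + m * s) with h | h
    · refine ⟨0, by linarith, le_rfl, fun t ht => abs_le.2 ⟨?_, ?_⟩⟩ <;>
        linarith [ht.1, ht.2]
    · refine ⟨-l, le_rfl, by linarith, fun t ht => abs_le.2 ⟨?_, ?_⟩⟩ <;>
        linarith [ht.1, ht.2]
  obtain ⟨σ, hσ, hσx⟩ : ∃ σ : ℤ, |(σ : ℝ)| = 1 ∧ ∀ k t : ℝ, 1 ≤ k → k ≤ n →
      |t - (t₀ + k * (σ * s))| ≤ l → |t - x| ≤ ρ := by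
    rw [abs_le] at hx
    rcases le_total t₀ x with h | h
    · refine ⟨1, by simp, fun k t hk hkn ht => ?_⟩
      have := mul_le_mul_of_nonneg_right hkn hs.le
      have := mul_le_mul_of_nonneg_right hk hs.le
      push_cast at ht
      rw [abs_le] at *
      constructor <;> linarith
    · refine ⟨-1, by simp, fun k t hk hkn ht => ?_⟩
      have := mul_le_mul_of_nonneg_right hkn hs.le
      have := mul_le_mul_of_nonneg_right hk hs.le
      push_cast at ht
      rw [abs_le] at *
      constructor <;> linarith
  refine mul_le_volume_real_of_Icc_subset (p := t₀ + u) (q := σ * s) ?_ n hl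
    (by rw [abs_mul, hσ, abs_of_pos hs]; linarith) fun k hk t ht => ?_
  · refine ((measure_mono (t := Metric.closedBall x ρ) ?_).trans_lt ?_).ne
    · exact fun t ht => ht.1.2
    · exact measure_closedBall_lt_top
  obtain ⟨hk1, hkn⟩ := Finset.mem_Icc.1 hk
  have hk1' : (1 : ℝ) ≤ k := by exact_mod_cast hk1
  have hkn' : (k : ℝ) ≤ n := by exact_mod_cast hkn
  have htl : |t - (t₀ + k * (σ * s))| ≤ l := by
    rw [abs_le]
    constructor <;> linarith [ht.1, ht.2]
  refine ⟨⟨⟨m + k * σ, ?_⟩, ?_⟩, ⟨m' + k * σ, ?_⟩, ?_⟩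
  · have h := hu (t - k * (σ * s)) ⟨by linarith [ht.1], by linarith [ht.2]⟩
    push_cast
    convert h using 2
    ring
  · rw [Metric.mem_closedBall, Real.dist_eq]
    exact hσx k t hk1' hkn' htl
  · have h : t - (y + ((m' + k * σ : ℤ) : ℝ) * s') = (t - (t₀ + k * (σ * s))) +
        (t₀ - (y + m' * s')) + k * σ * (s - s') := by push_cast; ring
    rw [h]
    have h3 : |k * σ * (s - s')| ≤ n * |s - s'| := by
      rw [abs_mul, abs_mul, hσ, mul_one, Nat.abs_cast]
      gcongr
    linarith [abs_add_three (t - (t₀ + k * (σ * s))) (t₀ - (y + m' * s')) (k * σ * (s - s'))]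
  · rw [Metric.mem_closedBall, Real.dist_eq]
    have h : t - y = (t - (t₀ + k * (σ * s))) + (t₀ - y) + k * σ * s := by ring
    have h3 : |k * σ * s| ≤ n * s := by
      rw [abs_mul, abs_mul, hσ, mul_one, Nat.abs_cast, abs_of_pos hs]
      gcongr
    rw [h]
    linarith [abs_add_three (t - (t₀ + k * (σ * s))) (t₀ - y) (k * σ * s)]

lemma setIntegral_sum_mul_indicator_one {ι : Type*} [Fintype ι] {S : ι → Set ℝ} {G : Set ℝ}
    (hS : ∀ i, MeasurableSet (S i)) (hG : volume G ≠ ⊤) (D : ι → ℝ) :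
    ∫ t in G, ∑ i, D i * (S i).indicator (fun _ => (1 : ℝ)) t =
      ∑ i, D i * volume.real (S i ∩ G) := by
  have hint : ∀ i, Integrable ((S i).indicator fun _ => (1 : ℝ)) (volume.restrict G) :=
    fun i => (integrableOn_const hG).indicator (hS i)
  rw [integral_finsetSum _ fun i _ => (hint i).const_mul _]
  refine Finset.sum_congr rfl fun i _ => ?_
  rw [integral_const_mul, integral_indicator_const _ (hS i),
    measureReal_restrict_apply (hS i), smul_eq_mul, mul_one]

lemma bilinear_average_le {ι κ : Type*} [Fintype ι] [Fintype κ] {P : ι → Set ℝ}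
    {Q : κ → Set ℝ} (hP : ∀ i, MeasurableSet (P i)) (hQ : ∀ j, MeasurableSet (Q j))
    {E F : Set ℝ} (hE : volume E ≠ ⊤) (hF : volume F ≠ ⊤) {A : ι → ℝ} {B : κ → ℝ}
    (hA : ∀ i, 0 ≤ A i) (hB : ∀ j, 0 ≤ B j) {K : ℝ}
    (h : ∀ i j, (volume.real E)⁻¹ * volume.real (P i ∩ Q j ∩ E) ≤
      K * ((volume.real F)⁻¹ * volume.real (P i ∩ F)) *
        ((volume.real F)⁻¹ * volume.real (Q j ∩ F))) :
    (volume.real E)⁻¹ * ∫ t in E, (∑ i, A i * (P i).indicator (fun _ => (1 : ℝ)) t) *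
        (∑ j, B j * (Q j).indicator (fun _ => (1 : ℝ)) t) ≤
      K * ((volume.real F)⁻¹ *
          ∫ t in F, ∑ i, A i * (P i).indicator (fun _ => (1 : ℝ)) t) *
        ((volume.real F)⁻¹ *
          ∫ t in F, ∑ j, B j * (Q j).indicator (fun _ => (1 : ℝ)) t) := by
  have hprod : ∀ t, (∑ i, A i * (P i).indicator (fun _ => (1 : ℝ)) t) *
        (∑ j, B j * (Q j).indicator (fun _ => (1 : ℝ)) t) =
      ∑ z : ι × κ, A z.1 * B z.2 * (P z.1 ∩ Q z.2).indicator (fun _ => (1 : ℝ)) t := by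
    intro t
    rw [Finset.sum_mul_sum, Fintype.sum_prod_type]
    refine Finset.sum_congr rfl fun i _ => Finset.sum_congr rfl fun j _ => ?_
    have : (P i ∩ Q j).indicator (fun _ => (1 : ℝ)) t =
        (P i).indicator (fun _ => (1 : ℝ)) t * (Q j).indicator (fun _ => (1 : ℝ)) t := by
      by_cases h1 : t ∈ P i <;> by_cases h2 : t ∈ Q j <;> simp [h1, h2]
    rw [this]
    ring
  simp_rw [hprod]
  rw [setIntegral_sum_mul_indicator_one (fun z : ι × κ => (hP z.1).inter (hQ z.2)) hE,
    setIntegral_sum_mul_indicator_one hP hF, setIntegral_sum_mul_indicator_one hQ hF,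
    mul_assoc, mul_mul_mul_comm, Finset.sum_mul_sum, Fintype.sum_prod_type]
  simp_rw [Finset.mul_sum]
  refine Finset.sum_le_sum fun i _ => Finset.sum_le_sum fun j _ => ?_
  have := mul_le_mul_of_nonneg_left (h i j) (mul_nonneg (hA i) (hB j))
  calc _ = A i * B j * ((volume.real E)⁻¹ * volume.real (P i ∩ Q j ∩ E)) := by ring
    _ ≤ _ := this
    _ = _ := by ring

lemma inv_mul_le_of_mul_sq_le {E F V p q K : ℝ} (hE : 0 < E) (hF : 0 < F)
    (h : V * F ^ 2 ≤ K * (E * (p * q))) :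
    E⁻¹ * V ≤ K * (F⁻¹ * p) * (F⁻¹ * q) := by
  have h1 : K * (F⁻¹ * p) * (F⁻¹ * q) = E⁻¹ * (K * (E * (p * q)) / F ^ 2) := by
    field_simp
  rw [h1]
  gcongr
  rwa [le_div_iff₀ (by positivity)]

lemma volume_inter_closedBall_ne_top (S : Set ℝ) (x ρ : ℝ) :
    volume (S ∩ Metric.closedBall x ρ) ≠ ⊤ :=
  ((measure_mono Set.inter_subset_right).trans_lt measure_closedBall_lt_top).ne

lemma fatAP_pair_le_of_closedBall (P : Set ℝ) {x y r : ℝ} (hr : 0 < r) :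
    (volume.real (Metric.closedBall y r))⁻¹ *
        volume.real (P ∩ Metric.closedBall x r ∩ Metric.closedBall y r) ≤
      8 * ((volume.real (Metric.closedBall y (2 * r)))⁻¹ *
          volume.real (P ∩ Metric.closedBall y (2 * r))) *
        ((volume.real (Metric.closedBall y (2 * r)))⁻¹ *
          volume.real (Metric.closedBall x r ∩ Metric.closedBall y (2 * r))) := by
  rcases Set.eq_empty_or_nonempty (P ∩ Metric.closedBall x r ∩ Metric.closedBall y r) with
    h0 | ⟨t, ⟨-, htx⟩, hty⟩
  · rw [h0, measureReal_empty, mul_zero]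
    positivity
  have hxr : r ≤ volume.real (Metric.closedBall x r ∩ Metric.closedBall y (2 * r)) := by
    rw [Metric.mem_closedBall, Real.dist_eq, abs_le] at htx hty
    obtain ⟨b, hb⟩ : ∃ b, Set.Icc b (b + r) ⊆
        Metric.closedBall x r ∩ Metric.closedBall y (2 * r) := by
      rcases le_total x y with h | h
      · refine ⟨x, fun z hz => ⟨?_, ?_⟩⟩ <;>
          rw [Metric.mem_closedBall, Real.dist_eq, abs_le] <;>
          constructor <;> linarith [hz.1, hz.2]
      · refine ⟨x - r, fun z hz => ⟨?_, ?_⟩⟩ <;>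
          rw [Metric.mem_closedBall, Real.dist_eq, abs_le] <;>
          constructor <;> linarith [hz.1, hz.2]
    have := measureReal_mono (μ := volume) hb (volume_inter_closedBall_ne_top _ _ _)
    rwa [Real.volume_real_Icc_of_le (by linarith), add_sub_cancel_left] at this
  have hP : volume.real (P ∩ Metric.closedBall x r ∩ Metric.closedBall y r) ≤
      volume.real (P ∩ Metric.closedBall y (2 * r)) := by
    refine measureReal_mono (fun z hz => ⟨hz.1.1, ?_⟩) (volume_inter_closedBall_ne_top _ _ _)
    exact Metric.closedBall_subset_closedBall (by linarith) hz.2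
  have h1 : volume.real (Metric.closedBall y r) = 2 * r := Real.volume_real_closedBall hr.le
  have h2 : volume.real (Metric.closedBall y (2 * r)) = 2 * (2 * r) :=
    Real.volume_real_closedBall (by linarith)
  rw [h1, h2]
  refine inv_mul_le_of_mul_sq_le (by positivity) (by positivity) ?_
  have := mul_le_mul hP hxr hr.le measureReal_nonneg
  nlinarith

set_option maxHeartbeats 1000000 in
lemma fatAP_pair_le {C c : ℝ} (hC : 128 ≤ C) (hc : 0 < c) {T l θ s s₁ s₂ x₁ x₂ y : ℝ}
    (hl : 1 ≤ l) (hlT : l ≤ T) (hθ : 0 < θ) (hθ1 : θ ≤ 1)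
    (hs : s ∈ Set.Icc (T ^ 2 / 8) (4 * T ^ 2)) (hs₁ : s₁ ∈ Set.Icc (T ^ 2 / 8) (4 * T ^ 2))
    (hs₂ : s₂ ∈ Set.Icc (T ^ 2 / 8) (4 * T ^ 2)) (hs₁s : |s₁ - s| ≤ 64 * θ * T)
    (hs₂s : |s₂ - s| ≤ 64 * θ * T) (hd : c * T * θ ≤ |s₁ - s₂|) {w W r : ℝ}
    (hw : w = C * T ^ 2 / l) (hW : W = C * T ^ 3 / l ^ 2)
    (hr : r = C * (T ^ 2) ^ 2 / (l ^ 2 * θ)) {P Q E F : Set ℝ}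
    (hP : P = APnbhd s₁ w x₁ ∩ Metric.closedBall x₁ r)
    (hQ : Q = APnbhd s₂ w x₂ ∩ Metric.closedBall x₂ r)
    (hE : E = APnbhd s W y ∩ Metric.closedBall y r)
    (hF : F = APnbhd s (2 * W) y ∩ Metric.closedBall y (2 * r)) :
    (volume.real E)⁻¹ * volume.real (P ∩ Q ∩ E) ≤
      65536 * C * (4 * C / c + 1) * (260 * C) ^ 2 * 2 * 4096 ^ 3 *
        ((volume.real F)⁻¹ * volume.real (P ∩ F)) *
        ((volume.real F)⁻¹ * volume.real (Q ∩ F)) := by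
  have hT : 1 ≤ T := hl.trans hlT
  have hT0 : 0 < T := by linarith
  have hl0 : 0 < l := by linarith
  have hC0 : 0 < C := by linarith
  have hw0 : 0 < w := by rw [hw]; positivity
  have hW0 : 0 < W := by rw [hW]; positivity
  have hr0 : 0 < r := by rw [hr]; positivity
  have hT8 : 0 < T ^ 2 / 8 := by positivity
  have hs0 : 0 < s := hT8.trans_le hs.1
  have hs₁0 : 0 < s₁ := hT8.trans_le hs₁.1
  have hs₂0 : 0 < s₂ := hT8.trans_le hs₂.1
  set μ : ℝ := min 1 (T / l ^ 2) with hμ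
  have hμ0 : 0 < μ := lt_min one_pos (by positivity)
  have hμ1 : μ ≤ 1 := min_le_left _ _
  have hμT : μ ≤ T / l ^ 2 := min_le_right _ _
  have hlθ : l * θ ≤ T := by nlinarith
  have hl2θ : l ^ 2 * θ ≤ T ^ 2 := by
    have : l ^ 2 ≤ T ^ 2 := by gcongr
    nlinarith [sq_nonneg l]
  have hrT : C * T ^ 2 ≤ r := by
    rw [hr, le_div_iff₀ (by positivity)]
    have := mul_le_mul_of_nonneg_left hl2θ (by positivity : 0 ≤ C * T ^ 2)
    linarith
  have hWr : W ≤ r := by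
    rw [hW, hr, div_le_div_iff₀ (by positivity) (by positivity)]
    have : θ ≤ T := by linarith
    have := mul_le_mul_of_nonneg_left this (by positivity : 0 ≤ C * T ^ 3 * l ^ 2)
    linarith
  have hwr : w ≤ r := by
    refine le_trans ?_ hrT
    rw [hw]
    exact div_le_self (by positivity) hl
  set M : ℝ := C * T ^ 2 / (128 * l ^ 2 * θ) with hM
  have hM1 : 1 ≤ M := by
    rw [hM, le_div_iff₀ (by positivity)]
    have := mul_le_mul hC hl2θ (by positivity) (by positivity)
    linarith
  set n : ℕ := ⌊M⌋₊ with hn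
  have hnM : (n : ℝ) ≤ M := Nat.floor_le (by linarith)
  have hMn : M / 2 ≤ n := by
    have h1 : (1 : ℝ) ≤ n := by exact_mod_cast Nat.one_le_floor_iff _ |>.2 hM1
    have h2 := Nat.lt_floor_add_one M
    linarith
  have hMr : M * (4 * T ^ 2) = r / 32 := by
    rw [hM, hr]; field_simp; norm_num
  have hnρ : ∀ {s' l' : ℝ}, s' ≤ 4 * T ^ 2 → l' ≤ T ^ 2 / 16 → n * s' + l' ≤ r := by
    intro s' l' hs' hl'
    have : n * s' ≤ M * (4 * T ^ 2) :=
      (mul_le_mul_of_nonneg_left hs' n.cast_nonneg).trans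
        (mul_le_mul_of_nonneg_right hnM (by positivity))
    nlinarith [sq_nonneg T]
  have hlower : ∀ {s' x t : ℝ}, s' ∈ Set.Icc (T ^ 2 / 8) (4 * T ^ 2) →
      |s' - s| ≤ 64 * θ * T → t ∈ APnbhd s' w x ∩ Metric.closedBall x r → t ∈ E →
      r / (4096 * l) ≤ volume.real ((APnbhd s' w x ∩ Metric.closedBall x r) ∩ F) := by
    intro s' x t hs' hs's ht htE
    have hl16 : T ^ 2 / (16 * l) ≤ T ^ 2 / 16 := by gcongr; linarith
    have h := mul_le_volume_real_fatAP_inter (l := T ^ 2 / (16 * l)) n (by positivity) ?_ ?_ ?_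
      (hnρ hs'.2 hl16) ht (hE ▸ htE)
    · rw [hF]
      refine le_trans ?_ h
      calc r / (4096 * l) = M / 2 * (T ^ 2 / (16 * l)) := by
            rw [hr, hM]; field_simp; norm_num
        _ ≤ _ := by gcongr
    · rw [hw, div_le_div_iff₀ (by positivity) (by positivity)]
      have := mul_le_mul_of_nonneg_right (by linarith : 1 ≤ C * 16)
        (by positivity : 0 ≤ T ^ 2 * l)
      linarith
    · have := hs'.1
      linarith
    · have h1 : n * |s' - s| ≤ M * (64 * θ * T) := by gcongr
      have h2 : M * (64 * θ * T) = W / 2 := by rw [hM, hW]; field_simp; norm_num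
      have h3 : T ^ 2 / (16 * l) ≤ W / 2 := by
        rw [hW, div_div, div_le_div_iff₀ (by positivity) (by positivity)]
        have := mul_le_mul hlT (by linarith : 1 ≤ C) zero_le_one hT0.le
        have := mul_le_mul_of_nonneg_left this (by positivity : 0 ≤ T ^ 2 * l)
        nlinarith [(by positivity : 0 ≤ T ^ 3 * C * l)]
      linarith
  have hElower : r * μ / 4096 ≤ volume.real E := by
    have hy : y ∈ APnbhd s W y ∩ Metric.closedBall y r :=
      ⟨⟨0, by simpa using hW0.le⟩, Metric.mem_closedBall_self hr0.le⟩
    have hl16 : T ^ 2 * μ / 16 ≤ T ^ 2 / 16 := by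
      gcongr
      exact mul_le_of_le_one_right (by positivity) hμ1
    have hlW : T ^ 2 * μ / 16 ≤ W := by
      calc T ^ 2 * μ / 16 ≤ T ^ 2 * (T / l ^ 2) / 16 := by gcongr
        _ = T ^ 3 / l ^ 2 / 16 := by ring
        _ ≤ C * (T ^ 3 / l ^ 2) := by nlinarith [(by positivity : 0 < T ^ 3 / l ^ 2)]
        _ = W := by rw [hW]; ring
    have h := mul_le_volume_real_fatAP_inter (l := T ^ 2 * μ / 16) n (by positivity) hlW
      (by linarith [hs.1]) (by simpa using hlW) (hnρ hs.2 hl16) hy hy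
    have hsub := measureReal_mono (μ := volume) (Set.inter_subset_left
      (s := APnbhd s W y ∩ Metric.closedBall y r)
      (t := APnbhd s (2 * W) y ∩ Metric.closedBall y (2 * r)))
      (volume_inter_closedBall_ne_top _ _ _)
    rw [hE]
    refine le_trans ?_ (h.trans hsub)
    calc r * μ / 4096 = M / 2 * (T ^ 2 * μ / 16) := by
          rw [hr, hM]; field_simp; norm_num
      _ ≤ _ := by gcongr
  have hFupper : volume.real F ≤ 260 * C * (r * μ) := by
    have h1 : volume.real F ≤ 260 * C * (r * 1) := by
      have : volume.real F ≤ volume.real (Metric.closedBall y (2 * r)) := by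
        rw [hF]
        exact measureReal_mono Set.inter_subset_right measure_closedBall_lt_top.ne
      rw [Real.volume_real_closedBall (by positivity)] at this
      nlinarith
    have h2 : volume.real F ≤ 260 * C * (r * (T / l ^ 2)) := by
      have h := ENNReal.toReal_le_of_le_ofReal (by positivity)
        (volume_fatAP_le y hs0 (by positivity : 0 ≤ 2 * W) (by positivity : 0 ≤ 2 * r))
      rw [← hF] at h
      refine h.trans ?_
      have h3 : 2 * (2 * r + 2 * W) / s + 1 ≤ 65 * (r / T ^ 2) := by
        have h4 : 2 * (2 * r + 2 * W) / s ≤ 8 * r / (T ^ 2 / 8) :=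
          div_le_div₀ (by positivity) (by linarith) hT8 hs.1
        have h5 : 1 ≤ r / T ^ 2 := by
          rw [le_div_iff₀ (by positivity)]
          nlinarith [sq_nonneg T]
        have h6 : 8 * r / (T ^ 2 / 8) = 64 * (r / T ^ 2) := by field_simp; norm_num
        linarith
      calc _ ≤ 65 * (r / T ^ 2) * (2 * (2 * W)) := by gcongr
        _ = _ := by rw [hW]; field_simp; norm_num
    rcases min_choice 1 (T / l ^ 2) with h | h <;> rw [hμ, h] <;> assumption
  have hne : s₁ ≠ s₂ := by
    rintro rfl
    rw [sub_self, abs_zero] at hd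
    exact absurd hd (not_le.2 (by positivity))
  have hPQupper : volume.real (P ∩ Q) ≤
      65536 * C * (4 * C / c + 1) * (r * (1 / T + 1 / l ^ 2)) := by
    have h := ENNReal.toReal_le_of_le_ofReal (by positivity)
      (volume_fatAP_inter_le x₁ x₂ hs₁0 hs₂0 hne hw0.le hr0.le)
    rw [← hP, ← hQ] at h
    refine h.trans ?_
    have hd' : |s₁ - s₂| ≤ 128 * θ * T := by
      rw [abs_le] at *
      constructor <;> linarith
    have h1 : 2 * (r + w) / s₁ * |s₁ - s₂| ≤ 4 * r / (T ^ 2 / 8) * (128 * θ * T) :=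
      mul_le_mul (div_le_div₀ (by positivity) (by linarith) hT8 hs₁.1) hd' (abs_nonneg _)
        (by positivity)
    have h2 : (4 * w + 2 * (r + w) / s₁ * |s₁ - s₂|) / s₂ ≤
        (4 * (C * T ^ 2) + 4 * r / (T ^ 2 / 8) * (128 * θ * T)) / (T ^ 2 / 8) := by
      gcongr
      · rw [hw]
        exact div_le_self (by positivity) hl
      · exact hs₂.1
    have h3 : (4 * (C * T ^ 2) + 4 * r / (T ^ 2 / 8) * (128 * θ * T)) / (T ^ 2 / 8) =
        32 * C + 32768 * C * (T / l ^ 2) := by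
      have : r = C * (T ^ 2) ^ 2 / (l ^ 2 * θ) := hr
      rw [this]; field_simp; ring
    have h4 : (4 * w + 2 * (r + w) / s₁ * |s₁ - s₂|) / s₂ + 1 ≤
        32768 * C * (1 + T / l ^ 2) := by linarith
    have h5 : 4 * w / |s₁ - s₂| + 1 ≤ (4 * C / c + 1) * (T / (l * θ)) := by
      have h6 : 4 * w / |s₁ - s₂| ≤ 4 * w / (c * T * θ) := by gcongr
      have h7 : 4 * w / (c * T * θ) = 4 * C / c * (T / (l * θ)) := by
        rw [hw]; field_simp
      have h8 : 1 ≤ T / (l * θ) := by rwa [one_le_div₀ (by positivity)]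
      linarith
    calc _ ≤ 32768 * C * (1 + T / l ^ 2) * ((4 * C / c + 1) * (T / (l * θ)) * (2 * w)) := by
          gcongr
      _ = _ := by rw [hw, hr]; field_simp; norm_num
  have hE0 : 0 < volume.real E := lt_of_lt_of_le (by positivity) hElower
  have hF0 : 0 < volume.real F := by
    refine hE0.trans_le (measureReal_mono ?_ (hF ▸ volume_inter_closedBall_ne_top _ _ _))
    rw [hE, hF]
    rintro t ⟨⟨m, hm⟩, ht⟩
    exact ⟨⟨m, by linarith⟩, Metric.closedBall_subset_closedBall (by linarith) ht⟩
  rcases Set.eq_empty_or_nonempty (P ∩ Q ∩ E) with h0 | ⟨t, ⟨htP, htQ⟩, htE⟩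
  · rw [h0, measureReal_empty, mul_zero]
    positivity
  have hPlower : r / (4096 * l) ≤ volume.real (P ∩ F) := by
    rw [hP] at htP ⊢
    exact hlower hs₁ hs₁s htP htE
  have hQlower : r / (4096 * l) ≤ volume.real (Q ∩ F) := by
    rw [hQ] at htQ ⊢
    exact hlower hs₂ hs₂s htQ htE
  have hV : volume.real (P ∩ Q ∩ E) ≤
      65536 * C * (4 * C / c + 1) * (r * (1 / T + 1 / l ^ 2)) := by
    refine (measureReal_mono Set.inter_subset_left ?_).trans hPQupper
    rw [hQ, ← Set.inter_assoc]
    exact volume_inter_closedBall_ne_top _ _ _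
  have hμl : (1 / T + 1 / l ^ 2) * μ ≤ 2 / l ^ 2 := by
    calc (1 / T + 1 / l ^ 2) * μ = 1 / T * μ + 1 / l ^ 2 * μ := by ring
      _ ≤ 1 / T * (T / l ^ 2) + 1 / l ^ 2 * 1 := by gcongr
      _ = 2 / l ^ 2 := by field_simp; norm_num
  refine inv_mul_le_of_mul_sq_le hE0 hF0 ?_
  set A : ℝ := 65536 * C * (4 * C / c + 1) with hA
  have hA0 : 0 < A := by positivity
  calc volume.real (P ∩ Q ∩ E) * volume.real F ^ 2
      ≤ A * (r * (1 / T + 1 / l ^ 2)) * (260 * C * (r * μ)) ^ 2 := by gcongr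
    _ = A * (260 * C) ^ 2 * r ^ 3 * μ * ((1 / T + 1 / l ^ 2) * μ) := by ring
    _ ≤ A * (260 * C) ^ 2 * r ^ 3 * μ * (2 / l ^ 2) := by gcongr
    _ = A * (260 * C) ^ 2 * 2 * 4096 ^ 3 *
        (r * μ / 4096 * (r / (4096 * l) * (r / (4096 * l)))) := by field_simp
    _ ≤ _ := by gcongr

lemma ShortGDS.le_diff_le {N θ : ℝ} {R : ℕ} {a : ℕ → ℝ} (h : ShortGDS N R θ a) (hθ : 0 < θ)
    {i : ℕ} (hi : 1 ≤ i) (hiR : i + 1 ≤ R) :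
    a 2 - a 1 ≤ a (i + 1) - a i ∧
      a (i + 1) - a i ≤ a 2 - a 1 + (i - 1) * (4 * θ / N ^ 2) := by
  induction i, hi using Nat.le_induction with
  | base => simp
  | succ i hi ih =>
    obtain ⟨h1, h2⟩ := ih (by omega)
    obtain ⟨h3, h4⟩ := h.2 i hi (by omega)
    have : 0 ≤ θ / (4 * N ^ 2) := by positivity
    refine ⟨by linarith, ?_⟩
    push_cast
    linarith

lemma ShortGDS.inv_diff_bounds {θ : ℝ} {R : ℕ} {a : ℕ → ℝ}
    (h : ShortGDS ((R : ℝ) ^ 2) R θ a) (hR : 1 ≤ R) (hθ : 0 < θ) (hθ1 : θ ≤ 1) {i : ℕ}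
    (hi : 1 ≤ i) (hiR : i + 1 ≤ R) :
    (a (i + 1) - a i)⁻¹ ∈ Set.Icc ((R : ℝ) ^ 2 / 8) (4 * (R : ℝ) ^ 2) ∧
      |(a (i + 1) - a i)⁻¹ - (a 2 - a 1)⁻¹| ≤ 64 * θ * R := by
  obtain ⟨h1, h2⟩ := h.le_diff_le hθ hi hiR
  obtain ⟨h3, h4⟩ := h.1
  have hR1 : (1 : ℝ) ≤ R := by exact_mod_cast hR
  have hR0 : (0 : ℝ) < R := by linarith
  have hiR' : (i : ℝ) + 1 ≤ R := by exact_mod_cast hiR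
  have h5 : ((i : ℝ) - 1) * (4 * θ / ((R : ℝ) ^ 2) ^ 2) ≤ 4 * θ / (R : ℝ) ^ 3 := by
    calc ((i : ℝ) - 1) * (4 * θ / ((R : ℝ) ^ 2) ^ 2) ≤ R * (4 * θ / ((R : ℝ) ^ 2) ^ 2) := by
          gcongr
          linarith
      _ = 4 * θ / (R : ℝ) ^ 3 := by field_simp
  have h6 : 4 * θ / (R : ℝ) ^ 3 ≤ 4 / (R : ℝ) ^ 2 := by
    gcongr
    · linarith
    · norm_num
  generalize a (i + 1) - a i = u at *
  generalize a 2 - a 1 = v at *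
  have hlow : 0 < 1 / (4 * (R : ℝ) ^ 2) := by positivity
  have hv : 0 < v := by linarith
  have hu : 0 < u := by linarith
  have hu' : u⁻¹ ≤ 4 * (R : ℝ) ^ 2 := by
    rw [inv_le_comm₀ hu (by positivity), ← one_div]
    linarith
  have hv' : v⁻¹ ≤ 4 * (R : ℝ) ^ 2 := by
    rw [inv_le_comm₀ hv (by positivity), ← one_div]
    linarith
  refine ⟨⟨?_, hu'⟩, ?_⟩
  · rw [le_inv_comm₀ (by positivity) hu, inv_div]
    have : 8 / (R : ℝ) ^ 2 = 4 / (R : ℝ) ^ 2 + 4 / (R : ℝ) ^ 2 := by ring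
    linarith
  · have h7 : u⁻¹ - v⁻¹ = -((u - v) * (u⁻¹ * v⁻¹)) := by
      field_simp
      ring
    rw [h7, abs_neg, abs_of_nonneg (mul_nonneg (by linarith) (by positivity))]
    calc (u - v) * (u⁻¹ * v⁻¹)
        ≤ 4 * θ / (R : ℝ) ^ 3 * (4 * (R : ℝ) ^ 2 * (4 * (R : ℝ) ^ 2)) := by
          gcongr
          linarith
      _ = 64 * θ * R := by field_simp; norm_num

lemma APnbhd_eq_univ {v δ : ℝ} (x : ℝ) (hv : 0 < v) (hδ : v ≤ δ) : APnbhd v δ x = Set.univ := by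
  refine Set.eq_univ_of_forall fun t => ⟨⌊(t - x) / v⌋, ?_⟩
  have h1 := Int.floor_le ((t - x) / v)
  have h2 := Int.lt_floor_add_one ((t - x) / v)
  rw [le_div_iff₀ hv] at h1
  rw [div_lt_iff₀ hv] at h2
  rw [abs_le]
  constructor <;> nlinarith

lemma measurableSet_PIset (C N θ : ℝ) (L : ℕ) (a : ℕ → ℝ) (j : ℕ) (x : ℝ) :
    MeasurableSet (PIset C N θ L a j x) :=
  (measurableSet_APnbhd _ _ _).inter Metric.isClosed_closedBall.measurableSet

lemma PLset_eq (s C N θ : ℝ) (L R : ℕ) (a : ℕ → ℝ) (y : ℝ) (hN : N = (R : ℝ) ^ 2) :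
    PLset s C N θ L a y = APnbhd (a 2 - a 1)⁻¹ (s * (C * (R : ℝ) ^ 3 / (L : ℝ) ^ 2)) y ∩
      Metric.closedBall y (s * (C * ((R : ℝ) ^ 2) ^ 2 / ((L : ℝ) ^ 2 * θ))) := by
  have h : ((R : ℝ) ^ 2) ^ ((3 : ℝ) / 2) = (R : ℝ) ^ 3 := by
    rw [← Real.rpow_natCast, ← Real.rpow_mul R.cast_nonneg, ← Real.rpow_natCast]
    norm_num
  rw [PLset, hN, h]

/-- The bilinear estimate for a single pair of transversal fat APs, for every transversality
constant `c`. -/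
lemma fatAP_pair_average_le {C c : ℝ} (hC : 128 ≤ C) (hc : 0 < c) {N R L : ℕ} {θ y x₁ x₂ : ℝ}
    {a : ℕ → ℝ} {j₁ j₂ : ℕ} (hN : 2 ≤ N) (hR : (R : ℝ) = Real.sqrt N) (hθ : 0 < θ)
    (hθ1 : θ ≤ 1) (hL : 1 ≤ L) (hLR : L ≤ R) (ha : ShortGDS N R θ a)
    (hj₁ : j₁ ∈ Finset.Icc 1 (R / L)) (hj₂ : j₂ ∈ Finset.Icc 1 (R / L))
    (hd : c * Real.sqrt N * θ ≤ |(vdiff a L j₁)⁻¹ - (vdiff a L j₂)⁻¹|) :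
    (volume.real (PLset 1 C N θ L a y))⁻¹ * volume.real (PIset C N θ L a j₁ x₁ ∩
        PIset C N θ L a j₂ x₂ ∩ PLset 1 C N θ L a y) ≤
      (65536 * C * (4 * C / c + 1) * (260 * C) ^ 2 * 2 * 4096 ^ 3) *
        ((volume.real (PLset 2 C N θ L a y))⁻¹ *
          volume.real (PIset C N θ L a j₁ x₁ ∩ PLset 2 C N θ L a y)) *
        ((volume.real (PLset 2 C N θ L a y))⁻¹ *
          volume.real (PIset C N θ L a j₂ x₂ ∩ PLset 2 C N θ L a y)) := by
  have hNR : (N : ℝ) = (R : ℝ) ^ 2 := by rw [hR, Real.sq_sqrt N.cast_nonneg]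
  have hR2 : 2 ≤ R := by
    have h : N = R ^ 2 := by exact_mod_cast hNR
    by_contra! h'
    interval_cases R <;> omega
  have hR2' : (2 : ℝ) ≤ R := by exact_mod_cast hR2
  have hL' : (1 : ℝ) ≤ L := by exact_mod_cast hL
  have hLR' : (L : ℝ) ≤ R := by exact_mod_cast hLR
  have hC0 : 0 < C := by linarith
  rw [← hR] at hd
  rw [hNR] at ha
  have hv : ∀ {i : ℕ}, 1 ≤ i → i + 1 ≤ R → _ := fun h1 h2 =>
    ha.inv_diff_bounds (by omega) hθ hθ1 h1 h2
  have hv₁ := (hv le_rfl hR2).1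
  rw [PLset_eq 1 C N θ L R a y hNR, PLset_eq 2 C N θ L R a y hNR, one_mul, one_mul]
  simp only [PIset, hNR]
  rcases hL.lt_or_eq with hL2 | rfl
  · have hj : ∀ {j : ℕ}, j ∈ Finset.Icc 1 (R / L) → (j - 1) * L + 1 + 1 ≤ R := by
      intro j hj
      obtain ⟨h1, h2⟩ := Finset.mem_Icc.1 hj
      have h3 := (Nat.mul_le_mul_right L h2).trans (Nat.div_mul_le_self R L)
      obtain ⟨k, rfl⟩ := Nat.exists_eq_add_of_le h1
      rw [Nat.add_sub_cancel_left]
      rw [add_mul] at h3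
      omega
    obtain ⟨h1, h1'⟩ := hv (Nat.le_add_left 1 _) (hj hj₁)
    obtain ⟨h2, h2'⟩ := hv (Nat.le_add_left 1 _) (hj hj₂)
    exact fatAP_pair_le hC hc hL' hLR' hθ hθ1 hv₁ h1 h2 h1' h2' hd rfl rfl rfl rfl rfl rfl rfl
  · have huniv : ∀ {v δ x : ℝ}, v ∈ Set.Icc ((R : ℝ) ^ 2 / 8) (4 * (R : ℝ) ^ 2) →
        4 * (R : ℝ) ^ 2 ≤ δ → APnbhd v δ x = Set.univ := fun hv hδ =>
      APnbhd_eq_univ _ ((by positivity : 0 < (R : ℝ) ^ 2 / 8).trans_le hv.1) (hv.2.trans hδ)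
    have hthick : 4 * (R : ℝ) ^ 2 ≤ C * (R : ℝ) ^ 2 / (1 : ℕ) := by
      rw [Nat.cast_one, div_one]
      gcongr
      linarith
    have hW : 4 * (R : ℝ) ^ 2 ≤ C * (R : ℝ) ^ 3 / ((1 : ℕ) : ℝ) ^ 2 := by
      rw [Nat.cast_one, one_pow, div_one]
      have := mul_le_mul (by linarith : 4 ≤ C) (by linarith : (1 : ℝ) ≤ R) zero_le_one hC0.le
      nlinarith [sq_nonneg (R : ℝ)]
    have hr : 0 < C * ((R : ℝ) ^ 2) ^ 2 / (((1 : ℕ) : ℝ) ^ 2 * θ) := by positivity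
    rw [huniv hv₁ hW, huniv hv₁ (by nlinarith [sq_nonneg (R : ℝ)]), Set.univ_inter,
      Set.univ_inter]
    have hK : (8 : ℝ) ≤ 65536 * C * (4 * C / c + 1) * (260 * C) ^ 2 * 2 * 4096 ^ 3 := by
      have h1 : 1 ≤ 4 * C / c + 1 := by
        have : 0 < 4 * C / c := by positivity
        linarith
      have h2 : (1 : ℝ) ≤ (260 * C) ^ 2 := one_le_pow₀ (by linarith)
      have h3 : (1 : ℝ) ≤ 65536 * C := by linarith
      have h4 := one_le_mul_of_one_le_of_one_le (one_le_mul_of_one_le_of_one_le h3 h1) h2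
      linarith
    have hball : ∀ {j : ℕ}, j ∈ Finset.Icc 1 (R / 1) → j ≠ R →
        ∀ x, APnbhd (vdiff a 1 j)⁻¹ (C * (R : ℝ) ^ 2 / (1 : ℕ)) x = Set.univ := by
      intro j hj hjR x
      obtain ⟨h1, h2⟩ := Finset.mem_Icc.1 hj
      rw [Nat.div_one] at h2
      refine huniv ?_ hthick
      have h3 : (j - 1) * 1 + 1 = j := by omega
      have h4 := (hv (i := (j - 1) * 1 + 1) (by omega) (by omega)).1
      exact h4
    have hne : j₁ ≠ R ∨ j₂ ≠ R := by
      by_contra! h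
      rw [h.1, h.2, sub_self, abs_zero] at hd
      exact absurd hd (not_le.2 (by positivity))
    rcases hne with h | h
    · rw [hball hj₁ h x₁, Set.univ_inter, Set.inter_comm (Metric.closedBall x₁ _)
        (APnbhd _ _ _ ∩ _), mul_right_comm]
      refine (fatAP_pair_le_of_closedBall _ hr).trans ?_
      gcongr
    · rw [hball hj₂ h x₂, Set.univ_inter]
      refine (fatAP_pair_le_of_closedBall _ hr).trans ?_
      gcongr

/-- bilinear Kakeya-type estimate for transversal families of dual fat
APs `P_I`, `P_J`. -/
theorem bilinear_kakeya_fatAP :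
    ∃ C₀ : ℝ, 1 ≤ C₀ ∧ ∃ c : ℝ, 0 < c ∧ ∃ K : ℝ, 0 < K ∧
      ∀ (N R L : ℕ) (θ y : ℝ) (a : ℕ → ℝ) (n₁ n₂ : ℕ)
        (j₁ : Fin n₁ → ℕ) (x₁ : Fin n₁ → ℝ) (A : Fin n₁ → ℝ)
        (j₂ : Fin n₂ → ℕ) (x₂ : Fin n₂ → ℝ) (B : Fin n₂ → ℝ),
        2 ≤ N → (R : ℝ) = Real.sqrt N → 0 < θ → θ ≤ 1 →
        1 ≤ L → L ≤ R → L ∣ R →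
        ShortGDS N R θ a →
        (∀ i, 0 < A i) → (∀ i, 0 < B i) →
        (∀ i, j₁ i ∈ Finset.Icc 1 (R / L)) → (∀ i, j₂ i ∈ Finset.Icc 1 (R / L)) →
        (∀ i i', c * Real.sqrt N * θ ≤
          |(vdiff a L (j₁ i))⁻¹ - (vdiff a L (j₂ i'))⁻¹|) →
        (volume (PLset 1 C₀ N θ L a y)).toReal⁻¹ *
            ∫ t in PLset 1 C₀ N θ L a y,
              (∑ i, A i * Set.indicator (PIset C₀ N θ L a (j₁ i) (x₁ i)) (fun _ => (1 : ℝ)) t) *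
              (∑ i, B i * Set.indicator (PIset C₀ N θ L a (j₂ i) (x₂ i)) (fun _ => (1 : ℝ)) t) ≤
          K * ((volume (PLset 2 C₀ N θ L a y)).toReal⁻¹ *
                ∫ t in PLset 2 C₀ N θ L a y,
                  ∑ i, A i * Set.indicator (PIset C₀ N θ L a (j₁ i) (x₁ i)) (fun _ => (1 : ℝ)) t) *
              ((volume (PLset 2 C₀ N θ L a y)).toReal⁻¹ *
                ∫ t in PLset 2 C₀ N θ L a y,
                  ∑ i, B i * Set.indicator (PIset C₀ N θ L a (j₂ i) (x₂ i)) (fun _ => (1 : ℝ)) t) := by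
  refine ⟨128, by norm_num, 1, one_pos,
    65536 * 128 * (4 * 128 / 1 + 1) * (260 * 128) ^ 2 * 2 * 4096 ^ 3, by norm_num, ?_⟩
  intro N R L θ y a n₁ n₂ j₁ x₁ A j₂ x₂ B hN hR hθ hθ1 hL hLR _ ha hA hB hj₁ hj₂ hd
  exact bilinear_average_le (fun i => measurableSet_PIset _ _ _ _ _ _ _)
    (fun i => measurableSet_PIset _ _ _ _ _ _ _) (volume_inter_closedBall_ne_top _ _ _)
    (volume_inter_closedBall_ne_top _ _ _) (fun i => (hA i).le) (fun i => (hB i).le)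
    fun i i' => fatAP_pair_average_le le_rfl one_pos hN hR hθ hθ1 hL hLR ha (hj₁ i) (hj₂ i')
      (hd i i')
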